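/- arXiv:1812.03565 — 3 statements merged into one kernel-verified Lean document; each statement's English description precedes it below -/
import Mathlib

section
/- With L(K) := A + BK = B(K − K⋆), define G(K) := 2(T−1) Bᵀ L(K) Σ + 2 Σ_{ℓ=2}^{T−1} Σ_{k=0}^{ℓ−1} (T−ℓ) Bᵀ (L(K)^k)ᵀ L(K)^ℓ Σ (L(K)^{ℓ−k−1})ᵀ. Then for every K ∈ ℝ^{d×n}, ⟨G(K), K − K⋆⟩_F = 2(T−1) Tr(L(K) Σ L(K)ᵀ) + 2 Σ_{ℓ=2}^{T−1} Σ_{k=0}^{ℓ−1} (T−ℓ) Tr(L(K)^ℓ Σ (L(K)^ℓ)ᵀ) ≥ 2(T−1) λ_min(Σ) σ_min(B)² ‖K − K⋆‖_F²; in particular K⋆ is the unique point where G vanishes (restricted strong convexity). -/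
open Matrix Finset

/-- The gradient of the finite-horizon LQR cost `J_Σ` at `K`:
`G(K) = 2(T−1) Bᵀ L(K) Σ
  + 2 Σ_{ℓ=2}^{T−1} Σ_{k=0}^{ℓ−1} (T−ℓ) Bᵀ (L(K)^k)ᵀ L(K)^ℓ Σ (L(K)^{ℓ−k−1})ᵀ`,
with closed-loop matrix `L(K) = A + BK`. -/
noncomputable def Gmat {n d : ℕ} (A : Matrix (Fin n) (Fin n) ℝ)
    (B : Matrix (Fin n) (Fin d) ℝ) (Sig : Matrix (Fin n) (Fin n) ℝ) (T : ℕ)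
    (K : Matrix (Fin d) (Fin n) ℝ) : Matrix (Fin d) (Fin n) ℝ :=
  (2 * ((T : ℝ) - 1)) • (Bᵀ * (A + B * K) * Sig) +
    (2 : ℝ) • ∑ ℓ ∈ Finset.Icc 2 (T - 1), ∑ k ∈ Finset.range ℓ,
      ((T : ℝ) - ℓ) •
        (Bᵀ * ((A + B * K) ^ k)ᵀ * (A + B * K) ^ ℓ * Sig * ((A + B * K) ^ (ℓ - k - 1))ᵀ)

open Classical in
/-- The minimum eigenvalue of a (Hermitian) real matrix. -/
noncomputable def matMinEig {n : ℕ} (M : Matrix (Fin n) (Fin n) ℝ) : ℝ :=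
  if h : M.IsHermitian then ⨅ i, h.eigenvalues i else 0

theorem matMinEig_nonneg {n : ℕ} {M : Matrix (Fin n) (Fin n) ℝ} (hM : M.PosSemidef) :
    0 ≤ matMinEig M := by
  rw [matMinEig, dif_pos hM.isHermitian]
  exact Real.iInf_nonneg hM.eigenvalues_nonneg

theorem matMinEig_pos {n : ℕ} [Nonempty (Fin n)] {M : Matrix (Fin n) (Fin n) ℝ}
    (hM : M.PosDef) : 0 < matMinEig M := by
  rw [matMinEig, dif_pos hM.isHermitian]
  obtain ⟨i, hi⟩ := exists_eq_ciInf_of_finite (f := hM.isHermitian.eigenvalues)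
  rw [← hi]
  exact hM.eigenvalues_pos i

open scoped MatrixOrder in
theorem posSemidef_sub_matMinEig_smul_one {n : ℕ} {M : Matrix (Fin n) (Fin n) ℝ}
    (hM : M.IsHermitian) : (M - matMinEig M • (1 : Matrix (Fin n) (Fin n) ℝ)).PosSemidef := by
  rw [← Matrix.le_iff, ← Algebra.algebraMap_eq_smul_one]
  refine algebraMap_le_of_le_spectrum (fun x hx => ?_) hM
  rw [hM.spectrum_real_eq_range_eigenvalues] at hx
  obtain ⟨i, rfl⟩ := hx
  rw [matMinEig, dif_pos hM]
  exact ciInf_le (Set.finite_range _).bddBelow i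

theorem matMinEig_mul_trace_le {n m : ℕ} {M : Matrix (Fin n) (Fin n) ℝ} (hM : M.IsHermitian)
    (X : Matrix (Fin m) (Fin n) ℝ) :
    matMinEig M * (X * Xᵀ).trace ≤ (X * M * Xᵀ).trace := by
  have h := ((posSemidef_sub_matMinEig_smul_one hM).mul_mul_conjTranspose_same X).trace_nonneg
  rw [conjTranspose_eq_transpose_of_trivial, Matrix.mul_sub, Matrix.sub_mul, trace_sub,
    Matrix.mul_smul, Matrix.smul_mul, Matrix.mul_one, trace_smul, smul_eq_mul] at h
  linarith

theorem trace_mul_mul_transpose_nonneg {n m : ℕ} {M : Matrix (Fin n) (Fin n) ℝ}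
    (hM : M.PosSemidef) (X : Matrix (Fin m) (Fin n) ℝ) : 0 ≤ (X * M * Xᵀ).trace := by
  simpa using (hM.mul_mul_conjTranspose_same X).trace_nonneg

theorem posDef_transpose_mul_self_of_rank {n d : ℕ} {B : Matrix (Fin n) (Fin d) ℝ}
    (hB : B.rank = d) : (Bᵀ * B).PosDef := by
  rw [← conjTranspose_eq_transpose_of_trivial]
  refine PosDef.conjTranspose_mul_self B ?_
  have h := B.mulVecLin.finrank_range_add_finrank_ker
  rw [Module.finrank_fin_fun, ← Matrix.rank, hB] at h
  have hker : LinearMap.ker B.mulVecLin = ⊥ := Submodule.finrank_eq_zero.mp (by omega)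
  exact LinearMap.ker_eq_bot.mp hker

theorem trace_pow_term {n d : ℕ} (B : Matrix (Fin n) (Fin d) ℝ) (E : Matrix (Fin d) (Fin n) ℝ)
    (Sig : Matrix (Fin n) (Fin n) ℝ) {k ℓ : ℕ} (hk : k < ℓ) :
    (Bᵀ * ((B * E) ^ k)ᵀ * (B * E) ^ ℓ * Sig * ((B * E) ^ (ℓ - k - 1))ᵀ * Eᵀ).trace
      = ((B * E) ^ ℓ * Sig * ((B * E) ^ ℓ)ᵀ).trace := by
  have hpow : (B * E) ^ ℓ = (B * E) ^ k * (B * E) * (B * E) ^ (ℓ - k - 1) := by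
    rw [← pow_succ, ← pow_add]
    congr 1
    omega
  have hT : ((B * E) ^ ℓ)ᵀ = ((B * E) ^ (ℓ - k - 1))ᵀ * (Eᵀ * (Bᵀ * ((B * E) ^ k)ᵀ)) := by
    rw [hpow]
    simp only [transpose_mul, Matrix.mul_assoc]
  rw [hT]
  simp only [Matrix.mul_assoc]
  rw [← Matrix.mul_assoc Bᵀ, trace_mul_comm]
  simp only [Matrix.mul_assoc]

theorem trace_Gmat_mul_transpose {n d : ℕ} {A : Matrix (Fin n) (Fin n) ℝ}
    {B : Matrix (Fin n) (Fin d) ℝ} {K E : Matrix (Fin d) (Fin n) ℝ}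
    (Sig : Matrix (Fin n) (Fin n) ℝ) (T : ℕ) (hE : A + B * K = B * E) :
    (Gmat A B Sig T K * Eᵀ).trace
      = 2 * ((T : ℝ) - 1) * ((A + B * K) * Sig * (A + B * K)ᵀ).trace
        + 2 * ∑ ℓ ∈ Finset.Icc 2 (T - 1), ∑ _k ∈ Finset.range ℓ,
            ((T : ℝ) - ℓ) * ((A + B * K) ^ ℓ * Sig * ((A + B * K) ^ ℓ)ᵀ).trace := by
  rw [Gmat, hE, Matrix.add_mul, trace_add, Matrix.smul_mul, Matrix.smul_mul, trace_smul,
    trace_smul, Matrix.sum_mul, trace_sum, smul_eq_mul, smul_eq_mul]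
  congr 2
  · simpa using trace_pow_term B E Sig one_pos
  · refine Finset.sum_congr rfl fun ℓ _ => ?_
    rw [Matrix.sum_mul, trace_sum]
    refine Finset.sum_congr rfl fun k hk => ?_
    rw [Matrix.smul_mul, trace_smul, smul_eq_mul, trace_pow_term B E Sig (Finset.mem_range.mp hk)]

theorem le_trace_Gmat_mul_transpose {n d : ℕ} {A : Matrix (Fin n) (Fin n) ℝ}
    {B : Matrix (Fin n) (Fin d) ℝ} {K E : Matrix (Fin d) (Fin n) ℝ}
    {Sig : Matrix (Fin n) (Fin n) ℝ} {T : ℕ} (hSig : Sig.PosSemidef) (hT : 1 ≤ T)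
    (hE : A + B * K = B * E) :
    2 * ((T : ℝ) - 1) * matMinEig Sig * matMinEig (Bᵀ * B) * (Eᵀ * E).trace
      ≤ (Gmat A B Sig T K * Eᵀ).trace := by
  have hsum : 0 ≤ ∑ ℓ ∈ Finset.Icc 2 (T - 1), ∑ _k ∈ Finset.range ℓ,
      ((T : ℝ) - ℓ) * ((A + B * K) ^ ℓ * Sig * ((A + B * K) ^ ℓ)ᵀ).trace := by
    refine Finset.sum_nonneg fun ℓ hℓ => Finset.sum_nonneg fun k _ =>
      mul_nonneg (sub_nonneg.mpr ?_) (trace_mul_mul_transpose_nonneg hSig _)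
    rw [Finset.mem_Icc] at hℓ
    exact_mod_cast (by omega : ℓ ≤ T)
  have hT' : (0 : ℝ) ≤ 2 * ((T : ℝ) - 1) := by
    have : (1 : ℝ) ≤ T := by exact_mod_cast hT
    linarith
  have hBE : matMinEig (Bᵀ * B) * (Eᵀ * E).trace ≤ (B * E * (B * E)ᵀ).trace := by
    have h := matMinEig_mul_trace_le (isHermitian_conjTranspose_mul_self B) Eᵀ
    rw [conjTranspose_eq_transpose_of_trivial, transpose_transpose] at h
    rw [trace_mul_comm (B * E)]
    simpa only [transpose_mul, Matrix.mul_assoc] using h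
  have hL : matMinEig Sig * (matMinEig (Bᵀ * B) * (Eᵀ * E).trace)
      ≤ ((A + B * K) * Sig * (A + B * K)ᵀ).trace := by
    rw [hE]
    exact (mul_le_mul_of_nonneg_left hBE (matMinEig_nonneg hSig)).trans
      (matMinEig_mul_trace_le hSig.isHermitian _)
  rw [trace_Gmat_mul_transpose Sig T hE]
  have := mul_le_mul_of_nonneg_left hL hT'
  linarith

theorem Gmat_eq_zero_of_closedLoop_eq_zero {n d : ℕ} {A : Matrix (Fin n) (Fin n) ℝ}
    {B : Matrix (Fin n) (Fin d) ℝ} {K : Matrix (Fin d) (Fin n) ℝ}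
    (Sig : Matrix (Fin n) (Fin n) ℝ) (T : ℕ) (hL : A + B * K = 0) : Gmat A B Sig T K = 0 := by
  rw [Gmat, hL, Finset.sum_eq_zero]
  · simp
  · intro ℓ hℓ
    have hℓ0 : ℓ ≠ 0 := by
      rw [Finset.mem_Icc] at hℓ
      omega
    simp [zero_pow hℓ0]

theorem eq_zero_of_Gmat_eq_zero {n d : ℕ} {A : Matrix (Fin n) (Fin n) ℝ}
    {B : Matrix (Fin n) (Fin d) ℝ} {K E : Matrix (Fin d) (Fin n) ℝ}
    {Sig : Matrix (Fin n) (Fin n) ℝ} {T : ℕ} (hB : B.rank = d) (hSig : Sig.PosDef) (hT : 2 ≤ T)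
    (hE : A + B * K = B * E) (hG : Gmat A B Sig T K = 0) : E = 0 := by
  rcases isEmpty_or_nonempty (Fin n) with hn | hn
  · ext i j
    exact hn.elim j
  rcases isEmpty_or_nonempty (Fin d) with hd | hd
  · ext i j
    exact hd.elim i
  have h := le_trace_Gmat_mul_transpose hSig.posSemidef (by omega : 1 ≤ T) hE
  rw [hG, Matrix.zero_mul, trace_zero] at h
  have hT' : (0 : ℝ) < 2 * ((T : ℝ) - 1) := by
    have : (2 : ℝ) ≤ T := by exact_mod_cast hT
    linarith
  have hc := mul_pos (mul_pos hT' (matMinEig_pos hSig))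
    (matMinEig_pos (posDef_transpose_mul_self_of_rank hB))
  have h0 : 0 ≤ (Eᵀ * E).trace := by
    simpa using (posSemidef_conjTranspose_mul_self E).trace_nonneg
  rw [← trace_conjTranspose_mul_self_eq_zero_iff, conjTranspose_eq_transpose_of_trivial]
  exact le_antisymm (nonpos_of_mul_nonpos_right h hc) h0

/-- **Restricted strong convexity of the LQR cost.**  With `L(K) = A + BK = B(K − K⋆)`,
for every `K`:
`⟨G(K), K − K⋆⟩_F = 2(T−1) Tr(L(K) Σ L(K)ᵀ)
   + 2 Σ_{ℓ=2}^{T−1} Σ_{k=0}^{ℓ−1} (T−ℓ) Tr(L(K)^ℓ Σ (L(K)^ℓ)ᵀ)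
 ≥ 2(T−1) λ_min(Σ) σ_min(B)² ‖K − K⋆‖_F²`,
and in particular `K⋆` is the unique point where `G` vanishes.
Here `⟨M,N⟩_F = Tr(MNᵀ)`, `‖M‖_F² = Tr(MᵀM)`, `σ_min(B)² = λ_min(BᵀB)`. -/
theorem Gmat_restricted_strong_convexity {n d : ℕ} (A : Matrix (Fin n) (Fin n) ℝ)
    (B : Matrix (Fin n) (Fin d) ℝ) (Kstar : Matrix (Fin d) (Fin n) ℝ)
    (Sig : Matrix (Fin n) (Fin n) ℝ) (T : ℕ)
    (hdn : d ≤ n) (hB : B.rank = d) (hK : A + B * Kstar = 0)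
    (hSig : Sig.PosDef) (hT : 2 ≤ T) :
    (∀ K : Matrix (Fin d) (Fin n) ℝ,
      (Gmat A B Sig T K * (K - Kstar)ᵀ).trace
        = 2 * ((T : ℝ) - 1) * ((A + B * K) * Sig * (A + B * K)ᵀ).trace
          + 2 * ∑ ℓ ∈ Finset.Icc 2 (T - 1), ∑ _k ∈ Finset.range ℓ,
              ((T : ℝ) - ℓ) * ((A + B * K) ^ ℓ * Sig * ((A + B * K) ^ ℓ)ᵀ).trace) ∧
    (∀ K : Matrix (Fin d) (Fin n) ℝ,
      2 * ((T : ℝ) - 1) * matMinEig Sig * matMinEig (Bᵀ * B) *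
          ((K - Kstar)ᵀ * (K - Kstar)).trace ≤
        (Gmat A B Sig T K * (K - Kstar)ᵀ).trace) ∧
    (∀ K : Matrix (Fin d) (Fin n) ℝ, Gmat A B Sig T K = 0 ↔ K = Kstar) := by
  have hE : ∀ K : Matrix (Fin d) (Fin n) ℝ, A + B * K = B * (K - Kstar) := fun K => by
    rw [Matrix.mul_sub, eq_neg_of_add_eq_zero_left hK]
    abel
  refine ⟨fun K => trace_Gmat_mul_transpose Sig T (hE K),
    fun K => le_trace_Gmat_mul_transpose hSig.posSemidef (by omega) (hE K),
    fun K => ⟨fun h => ?_, ?_⟩⟩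
  · exact sub_eq_zero.mp (eq_zero_of_Gmat_eq_zero hB hSig hT (hE K) h)
  · rintro rfl
    exact Gmat_eq_zero_of_closedLoop_eq_zero Sig T hK
end

section
/- Let B ∈ ℝ^{n×d} and let η be a Gaussian vector in ℝ^d with independent coordinates each distributed N(0, σ²), σ > 0. Then E[‖η‖₂² (‖Bη‖₂² − σ² ‖B‖_F²)²] = σ⁶ (2d + 8) ‖BᵀB‖_F². -/
open MeasureTheory ProbabilityTheory Matrix

lemma integrable_pow_gaussianReal (n : ℕ) :
    Integrable (fun x : ℝ ↦ x ^ n) (gaussianReal 0 1) :=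
  integrable_pow_of_mem_interior_integrableExpSet (X := id) (by simp) n

lemma integral_pow_mul_exp_gaussianReal_add_two (n : ℕ) (t : ℝ) :
    ∫ x : ℝ, x ^ (n + 2) * Real.exp (t * x) ∂gaussianReal 0 1 =
      t * ∫ x : ℝ, x ^ (n + 1) * Real.exp (t * x) ∂gaussianReal 0 1 +
        (n + 1) * ∫ x : ℝ, x ^ n * Real.exp (t * x) ∂gaussianReal 0 1 := by
  set M : ℕ → ℝ → ℝ := fun n t ↦ ∫ x : ℝ, x ^ n * Real.exp (t * x) ∂gaussianReal 0 1
  have hM (n : ℕ) (t : ℝ) : HasDerivAt (M n) (M (n + 1) t) t :=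
    hasDerivAt_integral_pow_mul_exp_real (X := id) (by simp) n
  have h_zero (t : ℝ) : M 0 t = Real.exp (t ^ 2 / 2) := by
    have := congrFun (mgf_fun_id_gaussianReal (μ := 0) (v := 1)) t
    simpa [mgf, M] using this
  have h_one (t : ℝ) : M 1 t = t * M 0 t := by
    refine (hM 0 t).unique ?_
    rw [funext h_zero]
    convert! (((hasDerivAt_id t).pow 2).div_const 2).exp using 1
    simp
    ring
  change M (n + 2) t = t * M (n + 1) t + (n + 1) * M n t
  induction n generalizing t with
  | zero =>
    have h := hM 1 t
    rw [funext h_one] at h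
    refine h.unique ?_
    convert! (hasDerivAt_id t).mul (hM 0 t) using 1
    simp
    ring
  | succ n ih =>
    have h := hM (n + 2) t
    rw [funext ih] at h
    refine h.unique ?_
    convert! ((hasDerivAt_id t).mul (hM (n + 1) t)).add ((hM n t).const_mul ((n : ℝ) + 1)) using 1
    rw [id_eq, add_assoc n 1 1]
    push_cast
    ring

lemma integral_pow_gaussianReal_add_two (n : ℕ) :
    ∫ x : ℝ, x ^ (n + 2) ∂gaussianReal 0 1 =
      (n + 1) * ∫ x : ℝ, x ^ n ∂gaussianReal 0 1 := by
  simpa using integral_pow_mul_exp_gaussianReal_add_two n 0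

lemma integral_sq_gaussianReal : ∫ x : ℝ, x ^ 2 ∂gaussianReal 0 1 = 1 := by
  simpa using integral_pow_gaussianReal_add_two 0

lemma integral_pow_four_gaussianReal : ∫ x : ℝ, x ^ 4 ∂gaussianReal 0 1 = 3 := by
  rw [integral_pow_gaussianReal_add_two 2, integral_sq_gaussianReal]
  norm_num

lemma integral_pow_six_gaussianReal : ∫ x : ℝ, x ^ 6 ∂gaussianReal 0 1 = 15 := by
  rw [integral_pow_gaussianReal_add_two 4, integral_pow_four_gaussianReal]
  norm_num

lemma integrable_sq_sub_one_pow_gaussianReal (n : ℕ) :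
    Integrable (fun x : ℝ ↦ (x ^ 2 - 1) ^ n) (gaussianReal 0 1) := by
  simp_rw [sub_eq_add_neg, add_pow, ← pow_mul]
  exact integrable_finsetSum _ fun i _ ↦
    ((integrable_pow_gaussianReal _).mul_const _).mul_const _

lemma integral_sq_sub_one_gaussianReal : ∫ x : ℝ, (x ^ 2 - 1) ∂gaussianReal 0 1 = 0 := by
  rw [integral_sub (integrable_pow_gaussianReal 2) (integrable_const _), integral_sq_gaussianReal]
  simp

lemma integral_sq_sub_one_sq_gaussianReal :
    ∫ x : ℝ, (x ^ 2 - 1) ^ 2 ∂gaussianReal 0 1 = 2 := by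
  have h (x : ℝ) : (x ^ 2 - 1) ^ 2 = x ^ 4 + (-2 * x ^ 2 + 1) := by ring
  have h₂ := (integrable_pow_gaussianReal 2).const_mul (-2)
  simp_rw [h]
  rw [integral_add (integrable_pow_gaussianReal 4) (h₂.fun_add (integrable_const _)),
    integral_add h₂ (integrable_const _), integral_const_mul, integral_sq_gaussianReal,
    integral_pow_four_gaussianReal]
  norm_num

lemma integral_sq_sub_one_cube_gaussianReal :
    ∫ x : ℝ, (x ^ 2 - 1) ^ 3 ∂gaussianReal 0 1 = 8 := by
  have h (x : ℝ) : (x ^ 2 - 1) ^ 3 = x ^ 6 + -3 * x ^ 4 + (3 * x ^ 2 + -1) := by ring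
  have h₂ := (integrable_pow_gaussianReal 2).const_mul 3
  have h₄ := (integrable_pow_gaussianReal 4).const_mul (-3)
  simp_rw [h]
  rw [integral_add ((integrable_pow_gaussianReal 6).fun_add h₄) (h₂.fun_add (integrable_const _)),
    integral_add (integrable_pow_gaussianReal 6) h₄, integral_add h₂ (integrable_const _),
    integral_const_mul, integral_const_mul, integral_sq_gaussianReal,
    integral_pow_four_gaussianReal, integral_pow_six_gaussianReal]
  norm_num

section Diagonal

variable {ι : Type*} [Fintype ι] [DecidableEq ι]

lemma prod_sq_sub_one_pow_ite (x : ι → ℝ) (i : ι) :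
    ∏ l, (x l ^ 2 - 1) ^ (if l = i then 1 else 0) = x i ^ 2 - 1 := by
  simp

lemma integrable_sq_sub_one_mul_pi_gaussianReal (i j : ι) :
    Integrable (fun x : ι → ℝ ↦ (x i ^ 2 - 1) * (x j ^ 2 - 1))
      (Measure.pi fun _ ↦ gaussianReal 0 1) := by
  simp_rw [← prod_sq_sub_one_pow_ite _ i, ← prod_sq_sub_one_pow_ite _ j,
    ← Finset.prod_mul_distrib, ← pow_add]
  exact Integrable.fintype_prod (μ := fun _ ↦ gaussianReal 0 1)
    fun l ↦ integrable_sq_sub_one_pow_gaussianReal _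

lemma integrable_sq_sub_one_mul_mul_pi_gaussianReal (i j k : ι) :
    Integrable (fun x : ι → ℝ ↦ (x i ^ 2 - 1) * (x j ^ 2 - 1) * (x k ^ 2 - 1))
      (Measure.pi fun _ ↦ gaussianReal 0 1) := by
  simp_rw [← prod_sq_sub_one_pow_ite _ i, ← prod_sq_sub_one_pow_ite _ j,
    ← prod_sq_sub_one_pow_ite _ k, ← Finset.prod_mul_distrib, ← pow_add]
  exact Integrable.fintype_prod (μ := fun _ ↦ gaussianReal 0 1)
    fun l ↦ integrable_sq_sub_one_pow_gaussianReal _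

lemma integral_sq_sub_one_mul_pi_gaussianReal (i j : ι) :
    ∫ x : ι → ℝ, (x i ^ 2 - 1) * (x j ^ 2 - 1) ∂(Measure.pi fun _ ↦ gaussianReal 0 1) =
      if i = j then 2 else 0 := by
  split_ifs with hij
  · subst hij
    simp_rw [← sq]
    rw [integral_comp_eval (μ := fun _ : ι ↦ gaussianReal 0 1) (f := fun x : ℝ ↦ (x ^ 2 - 1) ^ 2)
      (by fun_prop), integral_sq_sub_one_sq_gaussianReal]
  · simp_rw [← prod_sq_sub_one_pow_ite _ i, ← prod_sq_sub_one_pow_ite _ j,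
      ← Finset.prod_mul_distrib, ← pow_add]
    rw [integral_fintype_prod_eq_prod (fun l (x : ℝ) ↦ (x ^ 2 - 1) ^ _)]
    refine Finset.prod_eq_zero (Finset.mem_univ i) ?_
    simp [hij, integral_sq_sub_one_gaussianReal]

lemma integral_sq_sub_one_mul_mul_pi_gaussianReal (i j k : ι) :
    ∫ x : ι → ℝ, (x i ^ 2 - 1) * (x j ^ 2 - 1) * (x k ^ 2 - 1)
        ∂(Measure.pi fun _ ↦ gaussianReal 0 1) =
      if i = j then if j = k then 8 else 0 else 0 := by
  by_cases h : i = j ∧ j = k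
  · obtain ⟨rfl, rfl⟩ := h
    simp_rw [← sq, ← pow_succ]
    rw [integral_comp_eval (μ := fun _ : ι ↦ gaussianReal 0 1)
      (f := fun x : ℝ ↦ (x ^ 2 - 1) ^ (2 + 1)) (by fun_prop),
      integral_sq_sub_one_cube_gaussianReal]
    simp
  · rw [← ite_and, if_neg h]
    simp_rw [← prod_sq_sub_one_pow_ite _ i, ← prod_sq_sub_one_pow_ite _ j,
      ← prod_sq_sub_one_pow_ite _ k, ← Finset.prod_mul_distrib, ← pow_add]
    rw [integral_fintype_prod_eq_prod (fun l (x : ℝ) ↦ (x ^ 2 - 1) ^ _)]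
    obtain ⟨l, hl⟩ : ∃ l, (if l = i then 1 else 0) + (if l = j then 1 else 0) +
        (if l = k then 1 else 0) = 1 := by
      by_cases hij : i = j
      · exact ⟨k, by grind⟩
      · by_cases hik : i = k
        · exact ⟨j, by grind⟩
        · exact ⟨i, by grind⟩
    refine Finset.prod_eq_zero (Finset.mem_univ l) ?_
    simp only [hl, pow_one, integral_sq_sub_one_gaussianReal]

lemma integral_sum_sq_mul_sum_mul_sq_sub_one_sq (a : ι → ℝ) :
    ∫ x : ι → ℝ, (∑ k, x k ^ 2) * (∑ i, a i * (x i ^ 2 - 1)) ^ 2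
        ∂(Measure.pi fun _ ↦ gaussianReal 0 1) =
      (2 * Fintype.card ι + 8) * ∑ i, a i ^ 2 := by
  have h (x : ι → ℝ) : (∑ k, x k ^ 2) * (∑ i, a i * (x i ^ 2 - 1)) ^ 2 =
      ∑ i, ∑ j, a i * a j * (Fintype.card ι * ((x i ^ 2 - 1) * (x j ^ 2 - 1)) +
        ∑ k, (x i ^ 2 - 1) * (x j ^ 2 - 1) * (x k ^ 2 - 1)) := by
    have hx : ∑ k, x k ^ 2 = Fintype.card ι + ∑ k, (x k ^ 2 - 1) := by simp
    rw [hx, sq, Finset.sum_mul_sum, Finset.mul_sum]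
    refine Finset.sum_congr rfl fun i _ ↦ ?_
    rw [Finset.mul_sum]
    refine Finset.sum_congr rfl fun j _ ↦ ?_
    rw [← Finset.mul_sum]
    ring
  have h₂ (i j : ι) := (integrable_sq_sub_one_mul_pi_gaussianReal i j).const_mul (Fintype.card ι : ℝ)
  have h₃ (i j : ι) := integrable_finsetSum Finset.univ
    fun k _ ↦ integrable_sq_sub_one_mul_mul_pi_gaussianReal i j k
  have h₄ (i j : ι) := ((h₂ i j).fun_add (h₃ i j)).const_mul (a i * a j)
  simp_rw [h]
  rw [integral_finsetSum _ fun i _ ↦ integrable_finsetSum _ fun j _ ↦ h₄ i j, Finset.mul_sum]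
  refine Finset.sum_congr rfl fun i _ ↦ ?_
  rw [integral_finsetSum _ fun j _ ↦ h₄ i j]
  have h₅ (j : ι) : ∫ x : ι → ℝ, a i * a j * (Fintype.card ι * ((x i ^ 2 - 1) * (x j ^ 2 - 1)) +
        ∑ k, (x i ^ 2 - 1) * (x j ^ 2 - 1) * (x k ^ 2 - 1))
        ∂(Measure.pi fun _ ↦ gaussianReal 0 1) =
      if i = j then (2 * Fintype.card ι + 8) * a i ^ 2 else 0 := by
    rw [integral_const_mul, integral_add (h₂ i j) (h₃ i j), integral_const_mul,
      integral_finsetSum _ fun k _ ↦ integrable_sq_sub_one_mul_mul_pi_gaussianReal i j k]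
    simp_rw [integral_sq_sub_one_mul_pi_gaussianReal, integral_sq_sub_one_mul_mul_pi_gaussianReal]
    split_ifs with hij
    · subst hij
      simp
      ring
    · simp
  simp [h₅]

end Diagonal

section Rotation

variable {ι : Type*} [Fintype ι]

lemma integral_pi_gaussianReal_scale_rotate (σ : ℝ) (b : OrthonormalBasis ι ℝ (EuclideanSpace ℝ ι))
    {f : (ι → ℝ) → ℝ} (hf : Measurable f) :
    ∫ η, f η ∂(Measure.pi fun _ : ι ↦ gaussianReal 0 ⟨σ ^ 2, sq_nonneg σ⟩) =
      ∫ x : ι → ℝ, f (σ • (∑ i, x i • b i : EuclideanSpace ℝ ι).ofLp)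
        ∂(Measure.pi fun _ ↦ gaussianReal 0 1) := by
  have h_meas : Measurable fun x : ι → ℝ ↦ (∑ i, x i • b i : EuclideanSpace ℝ ι).ofLp :=
    (WithLp.measurable_ofLp 2 _).comp (by fun_prop)
  have h_meas_scale : Measurable fun (x : ι → ℝ) i ↦ σ * x i := by fun_prop
  have h_scale : (Measure.pi fun _ : ι ↦ gaussianReal 0 ⟨σ ^ 2, sq_nonneg σ⟩) =
      (Measure.pi fun _ : ι ↦ gaussianReal 0 1).map (fun x i ↦ σ * x i) := by
    rw [Measure.pi_map_pi (fun _ ↦ by fun_prop)]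
    simp_rw [gaussianReal_map_const_mul]
    simp only [mul_zero, mul_one]
    rfl
  have h_rotate : (Measure.pi fun _ : ι ↦ gaussianReal 0 1).map
      (fun x ↦ (∑ i, x i • b i : EuclideanSpace ℝ ι).ofLp) =
      Measure.pi fun _ : ι ↦ gaussianReal 0 1 := by
    change Measure.map (WithLp.ofLp ∘ fun x : ι → ℝ ↦ ∑ i, x i • b i) _ = _
    rw [← Measure.map_map (by fun_prop) (by fun_prop),
      ← stdGaussian_eq_map_pi_orthonormalBasis b, ← map_pi_eq_stdGaussian,
      Measure.map_map (by fun_prop) (by fun_prop)]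
    exact Measure.map_id
  rw [h_scale, integral_map h_meas_scale.aemeasurable hf.aestronglyMeasurable]
  conv_lhs => rw [← h_rotate]
  exact integral_map h_meas.aemeasurable (hf.comp h_meas_scale).aestronglyMeasurable

lemma sum_sq_sum_smul_orthonormalBasis (b : OrthonormalBasis ι ℝ (EuclideanSpace ℝ ι)) (x : ι → ℝ) :
    ∑ j, (∑ i, x i • b i : EuclideanSpace ℝ ι).ofLp j ^ 2 = ∑ i, x i ^ 2 := by
  rw [← EuclideanSpace.real_norm_sq_eq, ← b.sum_sq_norm_inner_right]
  simp [b.orthonormal.inner_right_fintype]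

variable [DecidableEq ι] {A : Matrix ι ι ℝ} (hA : A.IsHermitian)

lemma trace_transpose_mul_self_eq_sum_eigenvalues_sq :
    (Aᵀ * A).trace = ∑ i, hA.eigenvalues i ^ 2 := by
  have hAt : Aᵀ = A := hA
  rw [hAt]
  conv_lhs => rw [hA.spectral_theorem]
  rw [← map_mul, Unitary.conjStarAlgAut_apply, trace_mul_cycle, Unitary.coe_star_mul_self, one_mul,
    diagonal_mul_diagonal, trace_diagonal]
  simp [sq]

lemma dotProduct_mulVec_sum_eigenvectorBasis (x : ι → ℝ) :
    (∑ i, x i • hA.eigenvectorBasis i : EuclideanSpace ℝ ι).ofLp ⬝ᵥ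
      A *ᵥ (∑ i, x i • hA.eigenvectorBasis i : EuclideanSpace ℝ ι).ofLp =
      ∑ i, hA.eigenvalues i * x i ^ 2 := by
  have h : A *ᵥ (∑ i, x i • hA.eigenvectorBasis i : EuclideanSpace ℝ ι).ofLp =
      (∑ i, (x i * hA.eigenvalues i) • hA.eigenvectorBasis i : EuclideanSpace ℝ ι).ofLp := by
    simp [mulVec_sum, mulVec_smul, hA.mulVec_eigenvectorBasis, smul_smul]
  have h_inner := hA.eigenvectorBasis.orthonormal.inner_sum x
    (fun i ↦ x i * hA.eigenvalues i) Finset.univ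
  rw [EuclideanSpace.inner_eq_star_dotProduct, star_trivial, dotProduct_comm] at h_inner
  rw [h, h_inner]
  refine Finset.sum_congr rfl fun i _ ↦ ?_
  simp
  ring

end Rotation

/-- **Weighted variance of the Gaussian quadratic form `‖Bη‖₂²`.**
For `η ~ N(0, σ² I_d)`,
`E[‖η‖₂² (‖Bη‖₂² − σ² ‖B‖_F²)²] = σ⁶ (2d + 8) ‖BᵀB‖_F²`,
where `‖B‖_F² = Tr(BᵀB)` and `‖BᵀB‖_F² = Tr((BᵀB)ᵀ(BᵀB))`. -/
theorem gaussian_weighted_centered_moment {n d : ℕ} (B : Matrix (Fin n) (Fin d) ℝ)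
    (σ : ℝ) (hσ : 0 < σ) :
    ∫ η : Fin d → ℝ,
        (∑ i, η i ^ 2) * ((∑ i, B.mulVec η i ^ 2) - σ ^ 2 * (Bᵀ * B).trace) ^ 2
        ∂(Measure.pi fun _ : Fin d => gaussianReal 0 ⟨σ ^ 2, sq_nonneg σ⟩)
      = σ ^ 6 * (2 * d + 8) * ((Bᵀ * B)ᵀ * (Bᵀ * B)).trace := by
  have hA : (Bᵀ * B).IsHermitian := isHermitian_conjTranspose_mul_self B
  have h_quad (y : Fin d → ℝ) : ∑ i, (B *ᵥ y) i ^ 2 = y ⬝ᵥ (Bᵀ * B) *ᵥ y := by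
    rw [← mulVec_mulVec, dotProduct_mulVec, vecMul_transpose]
    simp [dotProduct, sq]
  rw [integral_pi_gaussianReal_scale_rotate σ hA.eigenvectorBasis (by fun_prop),
    trace_transpose_mul_self_eq_sum_eigenvalues_sq hA]
  have h_integrand (x : Fin d → ℝ) :
      (∑ j, (σ • (∑ i, x i • hA.eigenvectorBasis i : EuclideanSpace ℝ (Fin d)).ofLp) j ^ 2) *
        ((∑ j, (B *ᵥ (σ • (∑ i, x i • hA.eigenvectorBasis i :
          EuclideanSpace ℝ (Fin d)).ofLp)) j ^ 2) - σ ^ 2 * (Bᵀ * B).trace) ^ 2 =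
      σ ^ 6 * ((∑ k, x k ^ 2) * (∑ i, hA.eigenvalues i * (x i ^ 2 - 1)) ^ 2) := by
    have h_tr : (Bᵀ * B).trace = ∑ i, hA.eigenvalues i := by
      simpa using hA.trace_eq_sum_eigenvalues
    rw [h_quad, mulVec_smul, dotProduct_smul, smul_dotProduct,
      dotProduct_mulVec_sum_eigenvectorBasis hA, h_tr]
    simp only [Pi.smul_apply, smul_eq_mul, mul_pow, ← Finset.mul_sum]
    rw [sum_sq_sum_smul_orthonormalBasis]
    simp only [mul_sub, mul_one, Finset.sum_sub_distrib]
    ring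
  simp_rw [h_integrand]
  rw [integral_const_mul, integral_sum_sq_mul_sum_mul_sq_sub_one_sq, Fintype.card_fin, mul_assoc]
end

section
/- Let B ∈ ℝ^{n×d}, σ_u, σ_w > 0, and integer T ≥ 2. Let η_0, η_1, …, η_{T−1} be i.i.d. Gaussian vectors in ℝ^d with independent N(0, σ_u²) coordinates, and let w_0, …, w_{T−2} be i.i.d. Gaussian vectors in ℝ^n with independent N(0, σ_w²) coordinates, all mutually independent. Define x_t := B η_{t−1} + w_{t−1} for t = 1, …, T−1, and the advantage-baseline policy gradient at the optimum g := (1/σ_u²) Σ_{t=1}^{T−1} (‖B η_t‖₂² − σ_u² ‖B‖_F²) · η_t x_tᵀ ∈ ℝ^{d×n}. Then E[‖g‖_F²] = (T−1) (σ_u² ‖B‖_F² + σ_w² n) σ_u² (2d + 8) ‖BᵀB‖_F². -/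
open MeasureTheory ProbabilityTheory Matrix
open scoped NNReal ENNReal

/-- All moments of `f` with respect to `μ` are finite. -/
def HasAllMoments {Ω : Type*} [MeasurableSpace Ω] (f : Ω → ℝ) (μ : Measure Ω) : Prop :=
  ∀ p : ℝ≥0, MemLp f p μ

namespace HasAllMoments

variable {Ω Ω' : Type*} [MeasurableSpace Ω] [MeasurableSpace Ω'] {μ : Measure Ω} {ν : Measure Ω'}
  {f g : Ω → ℝ}

lemma integrable (hf : HasAllMoments f μ) : Integrable f μ :=
  memLp_one_iff_integrable.1 (by simpa using hf 1)

lemma add (hf : HasAllMoments f μ) (hg : HasAllMoments g μ) :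
    HasAllMoments (fun x => f x + g x) μ := fun p => (hf p).add (hg p)

lemma sub (hf : HasAllMoments f μ) (hg : HasAllMoments g μ) :
    HasAllMoments (fun x => f x - g x) μ := fun p => (hf p).sub (hg p)

lemma mul (hf : HasAllMoments f μ) (hg : HasAllMoments g μ) :
    HasAllMoments (fun x => f x * g x) μ := by
  intro p
  have : ENNReal.HolderTriple ((2 * p : ℝ≥0) : ℝ≥0∞) ((2 * p : ℝ≥0) : ℝ≥0∞) p := by
    constructor
    push_cast
    rw [ENNReal.mul_inv (by simp) (by simp), ← add_mul, ENNReal.inv_two_add_inv_two, one_mul]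
  exact (hg (2 * p)).mul' (hf (2 * p))

lemma sum {ι : Type*} {s : Finset ι} {f : ι → Ω → ℝ} (hf : ∀ i, HasAllMoments (f i) μ) :
    HasAllMoments (fun x => ∑ i ∈ s, f i x) μ :=
  fun p => memLp_finsetSum s fun i _ => hf i p

lemma const [IsFiniteMeasure μ] (c : ℝ) : HasAllMoments (fun _ => c) μ :=
  fun _ => memLp_const c

lemma pow [IsFiniteMeasure μ] (hf : HasAllMoments f μ) (k : ℕ) :
    HasAllMoments (fun x => f x ^ k) μ := by
  induction k with
  | zero => simpa using const 1
  | succ k ih => simpa only [pow_succ] using ih.mul hf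

lemma prod [IsFiniteMeasure μ] {ι : Type*} {s : Finset ι} {f : ι → Ω → ℝ}
    (hf : ∀ i, HasAllMoments (f i) μ) : HasAllMoments (fun x => ∏ i ∈ s, f i x) μ := by
  classical
  induction s using Finset.induction_on with
  | empty => simpa using const 1
  | insert i s hi ih => simpa only [Finset.prod_insert hi] using (hf i).mul ih

lemma comp {f : Ω' → ℝ} {φ : Ω → Ω'} (hf : HasAllMoments f ν) (hφ : MeasurePreserving φ μ ν) :
    HasAllMoments (fun x => f (φ x)) μ :=
  fun p => (hf p).comp_measurePreserving hφ

end HasAllMoments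

lemma hasAllMoments_id_gaussianReal (v : ℝ≥0) :
    HasAllMoments (fun x => x) (gaussianReal 0 v) :=
  fun p => memLp_id_gaussianReal p

/-- Recursion for the moments of a centred real Gaussian. -/
lemma integral_pow_succ_gaussianReal {v : ℝ≥0} (hv : v ≠ 0) (k : ℕ) :
    ∫ x, x ^ (k + 1) ∂gaussianReal 0 v = v * k * ∫ x, x ^ (k - 1) ∂gaussianReal 0 v := by
  have hv' : (v : ℝ) ≠ 0 := by exact_mod_cast hv
  have hI (m : ℕ) : Integrable (fun x : ℝ => gaussianPDFReal 0 v x * x ^ m) := by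
    have h := ((hasAllMoments_id_gaussianReal v).pow m).integrable
    rw [gaussianReal_of_var_ne_zero _ hv, integrable_withDensity_iff_integrable_smul'
      (measurable_gaussianPDF _ _) (ae_of_all _ fun _ => gaussianPDF_lt_top)] at h
    simpa using h
  have hpdf (x : ℝ) : HasDerivAt (gaussianPDFReal 0 v) (-(x / v) * gaussianPDFReal 0 v x) x := by
    have h1 : HasDerivAt (fun y : ℝ => -(y - 0) ^ 2 / (2 * v)) (-(x / v)) x := by
      have := (((hasDerivAt_id x).sub_const 0).pow 2).neg.div_const (2 * (v : ℝ))
      refine this.congr_deriv ?_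
      simp
      field_simp
    have := (h1.exp).const_mul (√(2 * Real.pi * v))⁻¹
    refine this.congr_deriv ?_
    simp only [gaussianPDFReal]
    ring
  have hD (x : ℝ) : HasDerivAt (fun x => gaussianPDFReal 0 v x * x ^ k)
      (k * (gaussianPDFReal 0 v x * x ^ (k - 1))
        - (v : ℝ)⁻¹ * (gaussianPDFReal 0 v x * x ^ (k + 1))) x := by
    refine ((hpdf x).mul (hasDerivAt_pow k x)).congr_deriv ?_
    ring
  have h0 := integral_eq_zero_of_hasDerivAt_of_integrable hD
    (((hI _).const_mul _).sub ((hI _).const_mul _)) (hI k)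
  rw [integral_sub ((hI _).const_mul _) ((hI _).const_mul _), integral_const_mul,
    integral_const_mul] at h0
  simp only [integral_gaussianReal_eq_integral_smul hv, smul_eq_mul]
  field_simp at h0
  linarith

section GaussianVector

variable {ι : Type*} [Fintype ι]

/-- The law of a vector with independent centred Gaussian coordinates of variance `v`. -/
noncomputable abbrev gaussianVector (ι : Type*) [Fintype ι] (v : ℝ≥0) : Measure (ι → ℝ) :=
  Measure.pi fun _ : ι => gaussianReal 0 v

lemma hasAllMoments_eval_gaussianVector (v : ℝ≥0) (i : ι) :
    HasAllMoments (fun z => z i) (gaussianVector ι v) :=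
  (hasAllMoments_id_gaussianReal v).comp (measurePreserving_eval _ i)

/-- The monomial with exponent `α`. -/
def monom (α : ι → ℕ) (z : ι → ℝ) : ℝ := ∏ i, z i ^ α i

lemma hasAllMoments_monom (v : ℝ≥0) (α : ι → ℕ) :
    HasAllMoments (monom α) (gaussianVector ι v) :=
  .prod fun i => (hasAllMoments_eval_gaussianVector v i).pow _

lemma integral_monom (v : ℝ≥0) (α : ι → ℕ) :
    ∫ z, monom α z ∂gaussianVector ι v = ∏ i, ∫ x, x ^ α i ∂gaussianReal 0 v :=
  integral_fintype_prod_eq_prod (fun i (x : ℝ) => x ^ α i)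

@[simp] lemma monom_zero (z : ι → ℝ) : monom 0 z = 1 := by simp [monom]

lemma integral_sum_monom {τ : Type*} [Fintype τ] (v : ℝ≥0) (c : τ → ℝ) (α : τ → ι → ℕ) :
    ∫ z, ∑ x, c x * monom (α x) z ∂gaussianVector ι v
      = ∑ x, c x * ∫ z, monom (α x) z ∂gaussianVector ι v := by
  rw [integral_finsetSum _ fun i _ => ((hasAllMoments_monom v _).integrable.const_mul _)]
  simp only [integral_const_mul]

variable [DecidableEq ι]

lemma monom_single_add (a : ι) (α : ι → ℕ) (z : ι → ℝ) :
    monom (Pi.single a 1 + α) z = z a * monom α z := by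
  simp only [monom, Pi.add_apply, pow_add, Finset.prod_mul_distrib]
  congr 1
  rw [Finset.prod_eq_single a] <;> simp +contextual

/-- Gaussian integration by parts for monomials. -/
lemma integral_eval_mul_monom {v : ℝ≥0} (hv : v ≠ 0) (a : ι) (α : ι → ℕ) :
    ∫ z, z a * monom α z ∂gaussianVector ι v
      = v * α a * ∫ z, monom (α - Pi.single a 1) z ∂gaussianVector ι v := by
  simp only [← monom_single_add]
  have hsplit (β : ι → ℕ) : ∏ i, ∫ x, x ^ β i ∂gaussianReal 0 v
      = (∫ x, x ^ β a ∂gaussianReal 0 v) *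
        ∏ i ∈ Finset.univ.erase a, ∫ x, x ^ β i ∂gaussianReal 0 v :=
    (Finset.mul_prod_erase _ _ (Finset.mem_univ a)).symm
  rw [integral_monom, integral_monom, hsplit, hsplit (α - _), ← mul_assoc]
  congr 1
  · simpa [add_comm] using integral_pow_succ_gaussianReal hv (α a)
  · refine Finset.prod_congr rfl fun i hi => ?_
    simp [Finset.ne_of_mem_erase hi]

/-- Multiplying a monomial by `‖z‖²` multiplies its Gaussian integral by `v (d + deg)`. -/
lemma integral_monom_mul_normSq {v : ℝ≥0} (hv : v ≠ 0) (α : ι → ℕ) :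
    ∫ z, monom α z * (z ⬝ᵥ z) ∂gaussianVector ι v
      = v * (Fintype.card ι + ∑ i, α i) * ∫ z, monom α z ∂gaussianVector ι v := by
  have h (i : ι) : ∫ z, z i * monom (Pi.single i 1 + α) z ∂gaussianVector ι v
      = v * (1 + α i) * ∫ z, monom α z ∂gaussianVector ι v := by
    rw [integral_eval_mul_monom hv]
    simp
  calc _ = ∫ z, ∑ i, z i * monom (Pi.single i 1 + α) z ∂gaussianVector ι v := by
        simp only [monom_single_add, dotProduct, Finset.mul_sum]
        congr! 3
        ring
    _ = _ := by
        rw [integral_finsetSum _ fun i _ =>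
          ((hasAllMoments_eval_gaussianVector v i).mul (hasAllMoments_monom v _)).integrable]
        simp only [h, ← Finset.sum_mul, ← Finset.mul_sum, Finset.sum_add_distrib]
        simp

lemma integral_eval_gaussianVector {v : ℝ≥0} (hv : v ≠ 0) (a : ι) :
    ∫ z, z a ∂gaussianVector ι v = 0 := by
  simpa using integral_eval_mul_monom hv a 0

lemma integral_eval_mul_eval {v : ℝ≥0} (hv : v ≠ 0) (a b : ι) :
    ∫ z, z a * z b ∂gaussianVector ι v = v * if a = b then 1 else 0 := by
  have := integral_eval_mul_monom hv a (Pi.single b 1 + 0)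
  simp only [monom_single_add, monom_zero, mul_one] at this
  rw [this]
  split_ifs with h
  · subst h; simp
  · simp [h]

/-- Fourth-order Wick formula. -/
lemma integral_eval_mul_four {v : ℝ≥0} (hv : v ≠ 0) (a b c e : ι) :
    ∫ z, z a * (z b * (z c * z e)) ∂gaussianVector ι v
      = v ^ 2 * ((if a = b then 1 else 0) * (if c = e then 1 else 0)
        + (if a = c then 1 else 0) * (if b = e then 1 else 0)
        + (if a = e then 1 else 0) * (if b = c then 1 else 0)) := by
  have h1 := integral_eval_mul_monom hv a (Pi.single b 1 + (Pi.single c 1 + (Pi.single e 1 + 0)))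
  simp only [monom_single_add, monom_zero, mul_one] at h1
  rw [h1]
  set M := ∫ z, monom (Pi.single b 1 + (Pi.single c 1 + (Pi.single e 1 + 0)) - Pi.single a 1) z
    ∂gaussianVector ι v with hM
  have h2 (i j k : ι) (h : Pi.single b 1 + (Pi.single c 1 + (Pi.single e 1 + (0 : ι → ℕ)))
      = Pi.single i 1 + (Pi.single j 1 + (Pi.single k 1 + 0))) :
      (if a = i then 1 else 0) * M = v * ((if a = i then 1 else 0) * if j = k then 1 else 0) := by
    by_cases hi : a = i
    · subst hi
      rw [hM, h, add_tsub_cancel_left]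
      simp only [monom_single_add, monom_zero, mul_one, integral_eval_mul_eval hv, if_true, one_mul]
    · simp [hi]
  have hb := h2 b c e rfl
  have hc := h2 c b e (by abel)
  have he := h2 e b c (by abel)
  have hα : (((Pi.single b 1 + (Pi.single c 1 + (Pi.single e 1 + 0)) : ι → ℕ) a : ℕ) : ℝ)
      = (if a = b then 1 else 0) + (if a = c then 1 else 0) + (if a = e then 1 else 0) := by
    simp [Pi.single_apply, add_assoc]
  rw [hα, mul_assoc, add_mul, add_mul, hb, hc, he]
  ring

lemma sum_mulVec_sq {κ : Type*} [Fintype κ] (B : Matrix κ ι ℝ) (z : ι → ℝ) :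
    ∑ i, (B *ᵥ z) i ^ 2 = ∑ x : ι × ι, (Bᵀ * B) x.1 x.2 *
      monom (Pi.single x.1 1 + (Pi.single x.2 1 + 0)) z := by
  simp only [monom_single_add, monom_zero, mul_one, Fintype.sum_prod_type, Matrix.mul_apply,
    Matrix.transpose_apply, Matrix.mulVec, dotProduct, sq, Finset.sum_mul_sum]
  simp only [Finset.sum_mul]
  rw [Finset.sum_comm]
  refine Finset.sum_congr rfl fun a _ => ?_
  rw [Finset.sum_comm]
  refine Finset.sum_congr rfl fun b _ => Finset.sum_congr rfl fun i _ => ?_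
  ring

lemma sum_mulVec_sq_sq {κ : Type*} [Fintype κ] (B : Matrix κ ι ℝ) (z : ι → ℝ) :
    (∑ i, (B *ᵥ z) i ^ 2) ^ 2 = ∑ x : (ι × ι) × ι × ι,
      ((Bᵀ * B) x.1.1 x.1.2 * (Bᵀ * B) x.2.1 x.2.2) *
      monom (Pi.single x.1.1 1 + (Pi.single x.1.2 1 +
        (Pi.single x.2.1 1 + (Pi.single x.2.2 1 + 0)))) z := by
  rw [sum_mulVec_sq, sq, Finset.sum_mul_sum, Fintype.sum_prod_type (fun x : (ι × ι) × ι × ι => _)]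
  refine Finset.sum_congr rfl fun a _ => Finset.sum_congr rfl fun b _ => ?_
  simp only [monom_single_add, monom_zero]
  ring

/-- `integral_monom_mul_normSq` for homogeneous polynomials. -/
lemma integral_sum_monom_mul_normSq {τ : Type*} [Fintype τ] {v : ℝ≥0} (hv : v ≠ 0) (c : τ → ℝ)
    (α : τ → ι → ℕ) (k : ℕ) (hα : ∀ x, ∑ i, α x i = k) :
    ∫ z, (∑ x, c x * monom (α x) z) * (z ⬝ᵥ z) ∂gaussianVector ι v
      = v * (Fintype.card ι + k) * ∫ z, ∑ x, c x * monom (α x) z ∂gaussianVector ι v := by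
  have hI (x : τ) : Integrable (fun z => c x * (monom (α x) z * (z ⬝ᵥ z))) (gaussianVector ι v) :=
    ((hasAllMoments_monom v _).mul (.sum fun i => (hasAllMoments_eval_gaussianVector v i).mul
      (hasAllMoments_eval_gaussianVector v i))).integrable.const_mul _
  simp only [Finset.sum_mul, mul_assoc (c _)]
  rw [integral_finsetSum _ fun x _ => hI x, integral_sum_monom, Finset.mul_sum]
  refine Finset.sum_congr rfl fun x _ => ?_
  rw [integral_const_mul, integral_monom_mul_normSq hv, ← hα x]
  push_cast
  ring

lemma integral_sum_mulVec_sq {κ : Type*} [Fintype κ] {v : ℝ≥0} (hv : v ≠ 0) (B : Matrix κ ι ℝ) :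
    ∫ z, ∑ i, (B *ᵥ z) i ^ 2 ∂gaussianVector ι v = v * (Bᵀ * B).trace := by
  simp only [sum_mulVec_sq, integral_sum_monom]
  simp only [monom_single_add, monom_zero, mul_one, integral_eval_mul_eval hv,
    Fintype.sum_prod_type, Matrix.trace, Matrix.diag, Finset.mul_sum]
  simp [mul_comm]

lemma integral_sum_mulVec_sq_sq {κ : Type*} [Fintype κ] {v : ℝ≥0} (hv : v ≠ 0)
    (B : Matrix κ ι ℝ) :
    ∫ z, (∑ i, (B *ᵥ z) i ^ 2) ^ 2 ∂gaussianVector ι v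
      = v ^ 2 * ((Bᵀ * B).trace ^ 2 + 2 * ((Bᵀ * B)ᵀ * (Bᵀ * B)).trace) := by
  have hG : (Bᵀ * B)ᵀ = Bᵀ * B := by simp
  simp only [sum_mulVec_sq_sq, integral_sum_monom]
  simp only [monom_single_add, monom_zero, mul_one, integral_eval_mul_four hv]
  generalize Bᵀ * B = G at *
  have hG' (i j) : G i j = G j i := congrFun (congrFun hG j) i
  simp only [Fintype.sum_prod_type, mul_add, Finset.sum_add_distrib]
  have h1 : G.trace ^ 2 = ∑ a, ∑ b, G a a * G b b := by
    rw [sq, Matrix.trace, Finset.sum_mul_sum]; rfl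
  have h2 : (Gᵀ * G).trace = ∑ a, ∑ b, G a b * G a b := by
    rw [hG]
    simp only [Matrix.trace, Matrix.diag, Matrix.mul_apply]
    exact Finset.sum_congr rfl fun a _ => Finset.sum_congr rfl fun b _ => by rw [hG' b a]
  have h3 : ∑ a, ∑ b, G a b * G b a = ∑ a, ∑ b, G a b * G a b :=
    Finset.sum_congr rfl fun a _ => Finset.sum_congr rfl fun b _ => by rw [hG' b a]
  rw [h1, h2]
  simp [← Finset.sum_mul, h3]
  ring

/-- The sixth-order Gaussian moment `E[(‖Bz‖² - v‖B‖²)² ‖z‖²]`. -/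
lemma integral_centred_sq_mul_normSq {κ : Type*} [Fintype κ] {v : ℝ≥0} (hv : v ≠ 0)
    (B : Matrix κ ι ℝ) :
    ∫ z, (∑ i, (B *ᵥ z) i ^ 2 - v * (Bᵀ * B).trace) ^ 2 * (z ⬝ᵥ z) ∂gaussianVector ι v
      = v ^ 3 * (2 * Fintype.card ι + 8) * ((Bᵀ * B)ᵀ * (Bᵀ * B)).trace := by
  set t := (Bᵀ * B).trace with ht
  have hN : HasAllMoments (fun z : ι → ℝ => z ⬝ᵥ z) (gaussianVector ι v) :=
    .sum fun i => (hasAllMoments_eval_gaussianVector v i).mul (hasAllMoments_eval_gaussianVector v i)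
  have hq : HasAllMoments (fun z : ι → ℝ => ∑ i, (B *ᵥ z) i ^ 2) (gaussianVector ι v) :=
    .sum fun i => .pow (.sum fun j => .mul (.const _) (hasAllMoments_eval_gaussianVector v j)) 2
  have h0 : ∫ z, z ⬝ᵥ z ∂gaussianVector ι v = v * Fintype.card ι := by
    simpa using integral_monom_mul_normSq hv (0 : ι → ℕ)
  have h1 : ∫ z, (∑ i, (B *ᵥ z) i ^ 2) * (z ⬝ᵥ z) ∂gaussianVector ι v
      = v * (Fintype.card ι + 2) * (v * t) := by
    rw [← integral_sum_mulVec_sq hv]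
    simp only [sum_mulVec_sq]
    exact integral_sum_monom_mul_normSq hv _ _ 2 (by simp [Finset.sum_add_distrib])
  have h2 : ∫ z, (∑ i, (B *ᵥ z) i ^ 2) ^ 2 * (z ⬝ᵥ z) ∂gaussianVector ι v
      = v * (Fintype.card ι + 4) *
        (v ^ 2 * (t ^ 2 + 2 * ((Bᵀ * B)ᵀ * (Bᵀ * B)).trace)) := by
    rw [← integral_sum_mulVec_sq_sq hv]
    simp only [sum_mulVec_sq_sq]
    exact integral_sum_monom_mul_normSq hv _ _ 4 (by simp [Finset.sum_add_distrib])
  have hexp (z : ι → ℝ) : (∑ i, (B *ᵥ z) i ^ 2 - v * t) ^ 2 * (z ⬝ᵥ z)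
      = (∑ i, (B *ᵥ z) i ^ 2) ^ 2 * (z ⬝ᵥ z)
        - 2 * (v * t) * ((∑ i, (B *ᵥ z) i ^ 2) * (z ⬝ᵥ z)) + (v * t) ^ 2 * (z ⬝ᵥ z) := by ring
  have i1 := (hq.mul hN).integrable
  have i2 := ((hq.pow 2).mul hN).integrable
  have i3 : Integrable (fun z => (∑ i, (B *ᵥ z) i ^ 2) ^ 2 * (z ⬝ᵥ z)
      - 2 * (v * t) * ((∑ i, (B *ᵥ z) i ^ 2) * (z ⬝ᵥ z))) (gaussianVector ι v) :=
    i2.sub (i1.const_mul _)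
  simp only [hexp]
  rw [integral_add i3 (hN.integrable.const_mul _),
    integral_sub i2 (i1.const_mul _), integral_const_mul, integral_const_mul, h0, h1, h2]
  ring

/-- Second moment of a Gaussian vector about an arbitrary point. -/
lemma integral_normSq_add {v : ℝ≥0} (hv : v ≠ 0) (c : ι → ℝ) :
    ∫ z, (c + z) ⬝ᵥ (c + z) ∂gaussianVector ι v = c ⬝ᵥ c + v * Fintype.card ι := by
  have hz := hasAllMoments_eval_gaussianVector (ι := ι) v
  have h0 : ∫ z, z ⬝ᵥ z ∂gaussianVector ι v = v * Fintype.card ι := by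
    simpa using integral_monom_mul_normSq hv (0 : ι → ℕ)
  have hexp (z : ι → ℝ) : (c + z) ⬝ᵥ (c + z) = c ⬝ᵥ c + 2 * (∑ i, c i * z i) + z ⬝ᵥ z := by
    simp only [add_dotProduct, dotProduct_add, dotProduct_comm z c]
    simp only [dotProduct]
    ring
  have hlin : ∫ z, ∑ i, c i * z i ∂gaussianVector ι v = 0 := by
    rw [integral_finsetSum _ fun i _ => (hz i).integrable.const_mul _]
    simp [integral_const_mul, integral_eval_gaussianVector hv]
  have i1 : Integrable (fun z => ∑ i, c i * z i) (gaussianVector ι v) :=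
    integrable_finsetSum _ fun i _ => (hz i).integrable.const_mul _
  have i2 : Integrable (fun z => z ⬝ᵥ z) (gaussianVector ι v) :=
    (HasAllMoments.sum fun i => (hz i).mul (hz i)).integrable
  simp only [hexp]
  have i3 : Integrable (fun z => c ⬝ᵥ c + 2 * ∑ i, c i * z i) (gaussianVector ι v) :=
    (integrable_const _).add (i1.const_mul _)
  rw [integral_add i3 i2,
    integral_add (integrable_const _) (i1.const_mul _), integral_const_mul, hlin, h0]
  simp

end GaussianVector

section SignFlip

lemma measurePreserving_neg_gaussianVector {ι : Type*} [Fintype ι] (v : ℝ≥0) :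
    MeasurePreserving (fun z => -z) (gaussianVector ι v) (gaussianVector ι v) := by
  refine ⟨measurable_neg, ?_⟩
  have : (fun z : ι → ℝ => -z) = fun z i => (fun x : ℝ => -x) (z i) := rfl
  rw [this, Measure.pi_map_pi fun _ => measurable_neg.aemeasurable]
  simp [gaussianReal_map_neg]

variable {τ ι Ω : Type*} [DecidableEq τ] [MeasurableSpace Ω]

/-- Reversal of the sign of the `i`-th vector of a family. -/
def flipAt (i : τ) (z : τ → ι → ℝ) : τ → ι → ℝ := fun j => if j = i then -z j else z j

lemma flipAt_same (i : τ) (z : τ → ι → ℝ) : flipAt i z i = -z i := by simp [flipAt]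

lemma flipAt_of_ne {i j : τ} (h : j ≠ i) (z : τ → ι → ℝ) : flipAt i z j = z j := by
  simp [flipAt, h]

variable [Fintype τ] [Fintype ι]

lemma measurePreserving_flipAt (v : ℝ≥0) (i : τ) :
    MeasurePreserving (flipAt i) (Measure.pi fun _ : τ => gaussianVector ι v)
      (Measure.pi fun _ : τ => gaussianVector ι v) := by
  have h (j : τ) : MeasurePreserving (fun z : ι → ℝ => if j = i then -z else z)
      (gaussianVector ι v) (gaussianVector ι v) := by
    split_ifs
    · exact measurePreserving_neg_gaussianVector v
    · exact .id _
  have hmap (j : τ) := (h j).map_eq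
  refine ⟨measurable_pi_lambda _ fun j => (h j).measurable.comp (measurable_pi_apply j), ?_⟩
  have (j : τ) : SigmaFinite
      ((gaussianVector ι v).map fun z : ι → ℝ => if j = i then -z else z) := by
    rw [hmap]; infer_instance
  have hpi := Measure.pi_map_pi (μ := fun _ : τ => gaussianVector ι v)
    (f := fun j (z : ι → ℝ) => if j = i then -z else z) fun j => (h j).measurable.aemeasurable
  simp only [hmap] at hpi
  exact hpi

/-- A function odd in one vector of an independent centred Gaussian family has zero integral. -/
lemma integral_eq_zero_of_odd (v : ℝ≥0) (ν : Measure Ω) [SFinite ν] (i : τ)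
    {f : (τ → ι → ℝ) × Ω → ℝ} (hf : ∀ p, f (flipAt i p.1, p.2) = -f p) :
    ∫ p, f p ∂(Measure.pi fun _ : τ => gaussianVector ι v).prod ν = 0 := by
  have hinv : Function.Involutive (Prod.map (flipAt i) id : (τ → ι → ℝ) × Ω → _) := by
    rintro ⟨z, w⟩
    refine Prod.ext (funext fun j => ?_) rfl
    by_cases h : j = i <;> simp [flipAt, h]
  have hm := (measurePreserving_flipAt (ι := ι) v i).prod (MeasurePreserving.id ν)
  have h := hm.integral_comp
    (MeasurableEquiv.ofInvolutive _ hinv hm.measurable).measurableEmbedding f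
  have hf' : ∀ p, f (Prod.map (flipAt i) id p) = -f p := hf
  simp only [hf', integral_neg] at h
  linarith

end SignFlip

section Gradient

variable {ι κ τ σ : Type*} [Fintype ι] [Fintype κ] [Fintype τ] [Fintype σ]

/-- Joint law of independent Gaussian inputs and disturbances. -/
noncomputable abbrev noiseLaw (τ ι σ κ : Type*) [Fintype τ] [Fintype ι] [Fintype σ] [Fintype κ]
    (v w : ℝ≥0) : Measure ((τ → ι → ℝ) × (σ → κ → ℝ)) :=
  (Measure.pi fun _ : τ => gaussianVector ι v).prod (Measure.pi fun _ : σ => gaussianVector κ w)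

lemma hasAllMoments_input (v w : ℝ≥0) (i : τ) (k : ι) :
    HasAllMoments (fun p => p.1 i k) (noiseLaw τ ι σ κ v w) := by
  have h : MeasurePreserving (fun p => p.1 i) (noiseLaw τ ι σ κ v w) (gaussianVector ι v) :=
    (measurePreserving_eval (fun _ : τ => gaussianVector ι v) i).comp measurePreserving_fst
  exact (hasAllMoments_eval_gaussianVector v k).comp h

lemma hasAllMoments_disturbance (v w : ℝ≥0) (s : σ) (k : κ) :
    HasAllMoments (fun p => p.2 s k) (noiseLaw τ ι σ κ v w) := by
  have h : MeasurePreserving (fun p => p.2 s) (noiseLaw τ ι σ κ v w) (gaussianVector κ w) :=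
    (measurePreserving_eval (fun _ : σ => gaussianVector κ w) s).comp measurePreserving_snd
  exact (hasAllMoments_eval_gaussianVector w k).comp h

lemma hasAllMoments_advantage (v w : ℝ≥0) (B : Matrix κ ι ℝ) (c : ℝ) (i : τ) :
    HasAllMoments (fun p => ∑ k, (B *ᵥ p.1 i) k ^ 2 - c) (noiseLaw τ ι σ κ v w) :=
  .sub (.sum fun _ => .pow (.sum fun _ => .mul (.const _) (hasAllMoments_input v w i _)) 2)
    (.const _)

lemma hasAllMoments_inner_input (v w : ℝ≥0) (i j : τ) :
    HasAllMoments (fun p => p.1 i ⬝ᵥ p.1 j) (noiseLaw τ ι σ κ v w) :=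
  .sum fun _ => (hasAllMoments_input v w i _).mul (hasAllMoments_input v w j _)

lemma hasAllMoments_inner_state (v w : ℝ≥0) (B : Matrix κ ι ℝ) (i j : τ) (s t : σ) :
    HasAllMoments (fun p => (B *ᵥ p.1 i + p.2 s) ⬝ᵥ (B *ᵥ p.1 j + p.2 t))
      (noiseLaw τ ι σ κ v w) := by
  have h (i : τ) (s : σ) (k : κ) :
      HasAllMoments (fun p => (B *ᵥ p.1 i + p.2 s) k) (noiseLaw τ ι σ κ v w) :=
    .add (.sum fun _ => .mul (.const _) (hasAllMoments_input v w i _))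
      (hasAllMoments_disturbance v w s k)
  exact .sum fun k => (h i s k).mul (h j t k)

/-- The diagonal contribution to the second moment of the policy gradient. -/
lemma integral_diagonal_term [DecidableEq ι] [DecidableEq κ] {v w : ℝ≥0}
    (hv : v ≠ 0) (hw : w ≠ 0) (B : Matrix κ ι ℝ) {i j : τ} (hij : i ≠ j) (s : σ) :
    ∫ p, ((∑ k, (B *ᵥ p.1 i) k ^ 2 - v * (Bᵀ * B).trace) ^ 2 * (p.1 i ⬝ᵥ p.1 i)) *
        ((B *ᵥ p.1 j + p.2 s) ⬝ᵥ (B *ᵥ p.1 j + p.2 s)) ∂noiseLaw τ ι σ κ v w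
      = (v ^ 3 * (2 * Fintype.card ι + 8) * ((Bᵀ * B)ᵀ * (Bᵀ * B)).trace) *
        (v * (Bᵀ * B).trace + w * Fintype.card κ) := by
  have hint := (((hasAllMoments_advantage (σ := σ) v w B (v * (Bᵀ * B).trace) i).pow 2).mul
    (hasAllMoments_inner_input v w i i)).mul (hasAllMoments_inner_state v w B j j s s)
  rw [integral_prod _ hint.integrable]
  have hinner (η : τ → ι → ℝ) : ∫ ε : σ → κ → ℝ, (B *ᵥ η j + ε s) ⬝ᵥ (B *ᵥ η j + ε s)
      ∂Measure.pi (fun _ : σ => gaussianVector κ w)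
      = ∑ k, (B *ᵥ η j) k ^ 2 + w * Fintype.card κ := by
    rw [integral_comp_eval (μ := fun _ : σ => gaussianVector κ w) (i := s)
      (f := fun z => (B *ᵥ η j + z) ⬝ᵥ (B *ᵥ η j + z))
      (by unfold dotProduct; fun_prop), integral_normSq_add hw]
    simp [dotProduct, sq]
  simp only [integral_const_mul, hinner]
  have hf : Continuous fun z : ι → ℝ =>
      (∑ k, (B *ᵥ z) k ^ 2 - v * (Bᵀ * B).trace) ^ 2 * (z ⬝ᵥ z) := by
    simp only [mulVec, dotProduct]
    fun_prop
  have hg : Continuous fun z : ι → ℝ => ∑ k, (B *ᵥ z) k ^ 2 + (w : ℝ) * Fintype.card κ := by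
    simp only [mulVec, dotProduct]
    fun_prop
  have hindep : (fun η : τ → ι → ℝ => η i) ⟂ᵢ[Measure.pi fun _ : τ => gaussianVector ι v]
      fun η => η j :=
    (iIndepFun_pi (X := fun _ : τ => id) fun _ => aemeasurable_id).indepFun hij
  rw [hindep.integral_fun_comp_mul_comp (measurable_pi_apply i).aemeasurable
      (measurable_pi_apply j).aemeasurable hf.aestronglyMeasurable hg.aestronglyMeasurable,
    integral_comp_eval (μ := fun _ : τ => gaussianVector ι v) (i := i) hf.aestronglyMeasurable,
    integral_comp_eval (μ := fun _ : τ => gaussianVector ι v) (i := j) hg.aestronglyMeasurable,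
    integral_centred_sq_mul_normSq hv]
  have hq : HasAllMoments (fun z : ι → ℝ => ∑ k, (B *ᵥ z) k ^ 2) (gaussianVector ι v) :=
    .sum fun _ => .pow (.sum fun _ => .mul (.const _) (hasAllMoments_eval_gaussianVector v _)) 2
  rw [integral_add hq.integrable (integrable_const _), integral_sum_mulVec_sq hv]
  simp

/-- Terms of the squared policy gradient at distinct times are uncorrelated: such a term is odd in
the input at an index `m` at which only one of its factors is odd. -/
lemma integral_off_diagonal_term [DecidableEq τ] (v w : ℝ≥0) (B : Matrix κ ι ℝ) (c : ℝ)
    {l m i j : τ} (hl : l ≠ m) (hi : i ≠ m) (hj : j ≠ m) (s t : σ) :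
    ∫ p, ((∑ k, (B *ᵥ p.1 l) k ^ 2 - c) * (∑ k, (B *ᵥ p.1 m) k ^ 2 - c) * (p.1 l ⬝ᵥ p.1 m)) *
        ((B *ᵥ p.1 i + p.2 s) ⬝ᵥ (B *ᵥ p.1 j + p.2 t)) ∂noiseLaw τ ι σ κ v w = 0 := by
  refine integral_eq_zero_of_odd v _ m fun p => ?_
  simp [flipAt_of_ne hl, flipAt_of_ne hi, flipAt_of_ne hj, flipAt_same, mulVec_neg]

/-- Second moment of a policy gradient whose `s`-th summand uses the input with index `a s` and the
state driven by the input with index `b s`, where `a s` does not occur before time `s`. -/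
theorem integral_trace_gradient [DecidableEq ι] [DecidableEq κ] [DecidableEq τ] [LinearOrder σ]
    {v w : ℝ≥0} (hv : v ≠ 0) (hw : w ≠ 0)
    (B : Matrix κ ι ℝ) {a b : σ → τ} (ha : Function.Injective a)
    (hab : ∀ s t, s ≤ t → b s ≠ a t) (r : ℝ) :
    ∫ p, ((r • ∑ s, (∑ k, (B *ᵥ p.1 (a s)) k ^ 2 - v * (Bᵀ * B).trace) •
          vecMulVec (p.1 (a s)) (B *ᵥ p.1 (b s) + p.2 s))ᵀ *
        (r • ∑ s, (∑ k, (B *ᵥ p.1 (a s)) k ^ 2 - v * (Bᵀ * B).trace) •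
          vecMulVec (p.1 (a s)) (B *ᵥ p.1 (b s) + p.2 s))).trace ∂noiseLaw τ ι σ κ v w
      = r ^ 2 * (Fintype.card σ *
        ((v ^ 3 * (2 * Fintype.card ι + 8) * ((Bᵀ * B)ᵀ * (Bᵀ * B)).trace) *
        (v * (Bᵀ * B).trace + w * Fintype.card κ))) := by
  set c := (v : ℝ) * (Bᵀ * B).trace with hc
  let F (s t : σ) (p : (τ → ι → ℝ) × (σ → κ → ℝ)) : ℝ :=
    ((∑ k, (B *ᵥ p.1 (a s)) k ^ 2 - c) * (∑ k, (B *ᵥ p.1 (a t)) k ^ 2 - c) *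
      (p.1 (a s) ⬝ᵥ p.1 (a t))) * ((B *ᵥ p.1 (b s) + p.2 s) ⬝ᵥ (B *ᵥ p.1 (b t) + p.2 t))
  have hF (s t : σ) : HasAllMoments (F s t) (noiseLaw τ ι σ κ v w) :=
    (((hasAllMoments_advantage v w B c _).mul (hasAllMoments_advantage v w B c _)).mul
      (hasAllMoments_inner_input v w _ _)).mul (hasAllMoments_inner_state v w B _ _ _ _)
  have hlt (s t : σ) (hst : s < t) : ∫ p, F s t p ∂noiseLaw τ ι σ κ v w = 0 :=
    integral_off_diagonal_term v w B c (ha.ne hst.ne) (hab s t hst.le) (hab t t le_rfl) s t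
  have hsymm (s t : σ) : F s t = F t s := by
    funext p
    simp only [F, dotProduct_comm (p.1 (a s)), dotProduct_comm (B *ᵥ p.1 (b s) + p.2 s)]
    ring
  have hdiag (s : σ) := integral_diagonal_term hv hw B (hab s s le_rfl).symm s
  have hval (s t : σ) : ∫ p, F s t p ∂noiseLaw τ ι σ κ v w = if s = t then
      (v ^ 3 * (2 * Fintype.card ι + 8) * ((Bᵀ * B)ᵀ * (Bᵀ * B)).trace) *
        (c + w * Fintype.card κ) else 0 := by
    rcases lt_trichotomy s t with h | rfl | h
    · rw [hlt s t h, if_neg h.ne]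
    · rw [if_pos rfl, ← hdiag s]
      simp only [F, ← sq, hc]
    · rw [hsymm, hlt t s h, if_neg h.ne']
  calc _ = ∫ p, r ^ 2 * ∑ s, ∑ t, F s t p ∂noiseLaw τ ι σ κ v w := by
        refine integral_congr_ae (ae_of_all _ fun p => ?_)
        simp only [transpose_smul, transpose_sum, transpose_vecMulVec, Matrix.smul_mul,
          Matrix.mul_smul, Matrix.sum_mul, Matrix.mul_sum, Finset.mul_sum,
          Finset.smul_sum, trace_smul, trace_sum,
          vecMulVec_mul_vecMulVec, trace_vecMulVec, dotProduct_smul, smul_eq_mul, F]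
        refine Finset.sum_congr rfl fun s _ => Finset.sum_congr rfl fun t _ => ?_
        rw [dotProduct_comm (p.1 (a t)), dotProduct_comm (B *ᵥ p.1 (b t) + p.2 t)]
        ring
    _ = _ := by
        rw [integral_const_mul, integral_finsetSum _ fun s _ =>
          integrable_finsetSum _ fun t _ => (hF s t).integrable]
        have hrow (s : σ) := integral_finsetSum Finset.univ fun t _ => (hF s t).integrable
        simp only [hrow, hval]
        simp

end Gradient

/-- **Second moment of the advantage-baseline policy gradient at the optimum.**
Let `η_0, …, η_{T−1} ~ N(0, σ_u² I_d)` and `w_0, …, w_{T−2} ~ N(0, σ_w² I_n)` be mutually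
independent.  With `x_t = B η_{t−1} + w_{t−1}` for `t = 1, …, T−1` and
`g = (1/σ_u²) Σ_{t=1}^{T−1} (‖B η_t‖₂² − σ_u² ‖B‖_F²) η_t x_tᵀ`, one has
`E[‖g‖_F²] = (T−1)(σ_u² ‖B‖_F² + σ_w² n) σ_u² (2d+8) ‖BᵀB‖_F²`.
(Below the sum over `t = 1, …, T−1` is reindexed as `t = s + 1` for `s : Fin (T−1)`;
`η` is indexed by `Fin T` and `w` by `Fin (T−1)`, and `‖M‖_F² = Tr(MᵀM)`.) -/
theorem advantage_baseline_policy_gradient_variance {n d : ℕ}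
    (B : Matrix (Fin n) (Fin d) ℝ) (σu σw : ℝ) (hσu : 0 < σu) (hσw : 0 < σw)
    (T : ℕ) (hT : 2 ≤ T) :
    ∫ p : (Fin T → (Fin d → ℝ)) × (Fin (T - 1) → (Fin n → ℝ)),
        (((1 / σu ^ 2) • ∑ s : Fin (T - 1),
            ((∑ i, B.mulVec (p.1 ⟨s.1 + 1, by have := s.2; omega⟩) i ^ 2)
                - σu ^ 2 * (Bᵀ * B).trace) •
              Matrix.vecMulVec (p.1 ⟨s.1 + 1, by have := s.2; omega⟩)
                (B.mulVec (p.1 ⟨s.1, by have := s.2; omega⟩) + p.2 s) :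
              Matrix (Fin d) (Fin n) ℝ)ᵀ *
          ((1 / σu ^ 2) • ∑ s : Fin (T - 1),
            ((∑ i, B.mulVec (p.1 ⟨s.1 + 1, by have := s.2; omega⟩) i ^ 2)
                - σu ^ 2 * (Bᵀ * B).trace) •
              Matrix.vecMulVec (p.1 ⟨s.1 + 1, by have := s.2; omega⟩)
                (B.mulVec (p.1 ⟨s.1, by have := s.2; omega⟩) + p.2 s))).trace
        ∂((Measure.pi fun _ : Fin T =>
              Measure.pi fun _ : Fin d => gaussianReal 0 ⟨σu ^ 2, sq_nonneg σu⟩).prod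
            (Measure.pi fun _ : Fin (T - 1) =>
              Measure.pi fun _ : Fin n => gaussianReal 0 ⟨σw ^ 2, sq_nonneg σw⟩))
      = ((T : ℝ) - 1) * (σu ^ 2 * (Bᵀ * B).trace + σw ^ 2 * n) * σu ^ 2 *
          (2 * d + 8) * ((Bᵀ * B)ᵀ * (Bᵀ * B)).trace := by
  have hu : (⟨σu ^ 2, sq_nonneg σu⟩ : ℝ≥0) ≠ 0 := fun h =>
    (pow_pos hσu 2).ne' (congrArg NNReal.toReal h)
  have hw : (⟨σw ^ 2, sq_nonneg σw⟩ : ℝ≥0) ≠ 0 := fun h =>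
    (pow_pos hσw 2).ne' (congrArg NNReal.toReal h)
  have h := integral_trace_gradient hu hw B
    (a := fun s : Fin (T - 1) => (⟨s.1 + 1, by have := s.2; omega⟩ : Fin T))
    (b := fun s : Fin (T - 1) => (⟨s.1, by have := s.2; omega⟩ : Fin T))
    (fun s t h => by simpa [Fin.ext_iff] using h)
    (fun s t h => by simp only [Ne, Fin.ext_iff]; have : s.1 ≤ t.1 := h; omega) (1 / σu ^ 2)
  refine h.trans ?_
  change (1 / σu ^ 2) ^ 2 * (_ * (((σu ^ 2) ^ 3 * _ * _) * (σu ^ 2 * _ + σw ^ 2 * _))) = _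
  simp only [Fintype.card_fin, Nat.cast_sub (by omega : 1 ≤ T), Nat.cast_one]
  field_simp
end
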